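/- arXiv:2208.04393 — 5 statements merged into one kernel-verified Lean document; each statement's English description precedes it below -/
import Mathlib

section
/- Let K be an algebraically closed field of characteristic zero, let n ≥ 2, and let F ∈ K[x_0,…,x_n] be homogeneous of degree d ≥ n such that the only common zero in K^{n+1} of the partial derivatives ∂F/∂x_0,…,∂F/∂x_n is the origin (i.e., X = {F = 0} ⊂ P^n is smooth). Then X is not swept out by lines: there exists a nonzero x ∈ K^{n+1} with F(x) = 0 such that no 2-dimensional K-linear subspace W ⊆ K^{n+1} containing x has F vanishing identically on W (i.e., no line of P^n through [x] is contained in X). -/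
open MvPolynomial

lemma aux_chain {K B σ : Type*} [Fintype σ] [Field K] [CommRing B] [Algebra K B]
    (D : Derivation K B B) (z : σ → B) (G : MvPolynomial σ K) :
    D (aeval z G) = ∑ i, aeval z (pderiv i G) * D (z i) := by
  classical
  induction G using MvPolynomial.induction_on with
  | C a => simp
  | add p q hp hq => simp [hp, hq, add_mul, Finset.sum_add_distrib]
  | mul_X p j hp =>
    simp only [map_mul, aeval_X, Derivation.leibniz, hp, smul_eq_mul, map_add, add_mul,
      Finset.sum_add_distrib, pderiv_X, Finset.mul_sum]
    congr 1
    · simp [Pi.single_apply, apply_ite]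
    · exact Finset.sum_congr rfl fun i _ => by ring

lemma aux_ext {K A E : Type} [Field K] [CommRing A] [Field E] [Algebra K A] [Algebra K E]
    [Algebra A E] [IsScalarTower K A E] [Algebra.FormallySmooth A E] (D0 : Derivation K A E) :
    ∃ D : Derivation K E E, ∀ a, D (algebraMap A E a) = D0 a := by
  have hinj : Function.Injective (KaehlerDifferential.mapBaseChange K A E) := by
    rw [injective_iff_map_eq_zero]
    intro z hz
    obtain ⟨w, rfl⟩ := (Algebra.H1Cotangent.exact_δ_mapBaseChange K A E z).1 hz
    rw [Subsingleton.elim w 0, map_zero]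
  obtain ⟨r, hr⟩ := LinearMap.exists_leftInverse_of_injective
    (KaehlerDifferential.mapBaseChange K A E) (LinearMap.ker_eq_bot.2 hinj)
  let φ : TensorProduct A E (Ω[A⁄K]) →ₗ[E] E := LinearMap.liftBaseChange E D0.liftKaehlerDifferential
  refine ⟨(φ ∘ₗ r).compDer (KaehlerDifferential.D K E), fun a => ?_⟩
  have h1 : KaehlerDifferential.D K E (algebraMap A E a) =
      KaehlerDifferential.mapBaseChange K A E (1 ⊗ₜ KaehlerDifferential.D K A a) := by
    simp
  have h2 := LinearMap.congr_fun hr (1 ⊗ₜ KaehlerDifferential.D K A a)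
  simp only [LinearMap.comp_apply, LinearMap.id_apply] at h2
  change φ (r (KaehlerDifferential.D K E (algebraMap A E a))) = D0 a
  rw [h1, h2]
  simp [φ]

lemma aux_fs {A E : Type} [CommRing A] [IsDomain A] [CharZero A] [Field E]
    [Algebra A E] [FaithfulSMul A E] : Algebra.FormallySmooth A E := by
  let L := FractionRing A
  have : CharZero L := inferInstance
  let _ : Algebra L E := FractionRing.liftAlgebra A E
  have : IsScalarTower A L E := inferInstance
  have h1 : Algebra.FormallySmooth A L := .of_isLocalization (nonZeroDivisors A)
  have h2 : Algebra.FormallySmooth L E := by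
    obtain ⟨s, hs⟩ := exists_isTranscendenceBasis L E
    have : Algebra.IsAlgebraic (IntermediateField.adjoin L (Set.range ((↑) : s → E))) E :=
      hs.isAlgebraic_field
    exact .of_algebraicIndependent_of_isSeparable hs.1
  exact .comp A L E

lemma aux_der {K E : Type} {m : ℕ} [Field K] [Field E] [Algebra K E] [CharZero K]
    (x : Fin m → E) (P : MvPolynomial (Fin m) K) (hP : ∀ g, aeval x g = 0 ↔ P ∣ g)
    (v : Fin m → E) (hv : ∑ i, aeval x (pderiv i P) * v i = 0) :
    ∃ D : Derivation K E E, ∀ i, D (x i) = v i := by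
  let A := (aeval (R := K) x).range
  have : CharZero E := charZero_of_injective_algebraMap (algebraMap K E).injective
  have : CharZero A := charZero_of_injective_algebraMap (algebraMap K A).injective
  have hfs : Algebra.FormallySmooth A E := aux_fs
  let δ : MvPolynomial (Fin m) K → E := fun g => ∑ i, aeval x (pderiv i g) * v i
  have δadd : ∀ g h, δ (g + h) = δ g + δ h := fun g h => by
    simp [δ, add_mul, Finset.sum_add_distrib]
  have δsmul : ∀ (c : K) h, δ (c • h) = c • δ h := fun g h => by
    simp [δ, Finset.smul_sum]
  have δmul : ∀ g h, δ (g * h) = aeval x g * δ h + aeval x h * δ g := fun g h => by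
    simp only [δ, Derivation.leibniz, map_add, map_mul, add_mul, Finset.sum_add_distrib,
      smul_eq_mul, Finset.mul_sum, mul_assoc]
  have δ0 : ∀ g, aeval x g = 0 → δ g = 0 := by
    intro g hg
    obtain ⟨q, rfl⟩ := (hP g).1 hg
    rw [δmul, (hP P).2 dvd_rfl, zero_mul, zero_add]
    simp only [δ, hv, mul_zero]
  have δwd : ∀ g h, aeval x g = aeval x h → δ g = δ h := by
    intro g h e
    have : δ (g - h) = 0 := δ0 _ (by rw [map_sub, e, sub_self])
    have h2 := δadd (g - h) h
    rw [sub_add_cancel, this, zero_add] at h2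
    exact h2
  have hs : ∀ a : A, ∃ g, aeval x g = (a : E) := fun a => a.2
  choose s hs using hs
  let D0 : Derivation K A E := Derivation.mk'
    { toFun := fun a => δ (s a)
      map_add' := fun a b => by rw [← δadd]; exact δwd _ _ (by simp [hs])
      map_smul' := fun c b => by
        rw [RingHom.id_apply, ← δsmul]; exact δwd _ _ (by simp [hs]) }
    (fun a b => by
      change δ (s (a * b)) = a • δ (s b) + b • δ (s a)
      rw [δwd _ (s a * s b) (by simp [hs]), δmul, hs, hs]
      rfl)
  obtain ⟨D, hD⟩ := aux_ext D0
  refine ⟨D, fun i => ?_⟩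
  have := hD ⟨x i, X i, by simp⟩
  change D (x i) = δ (s _) at this
  rw [this, δwd _ (X i) (by rw [hs]; simp)]
  classical
  simp [δ, pderiv_X, Pi.single_apply, apply_ite]

lemma aux_coeff {K E : Type} {m : ℕ} [Field K] [Field E] [Algebra K E]
    (x y : Fin m → E) (e : ℕ) (p : MvPolynomial (Fin m) K) (hp : p.IsHomogeneous e) :
    (aeval (fun i => Polynomial.C (x i) + Polynomial.X * Polynomial.C (y i)) p).coeff e
      = aeval y p := by
  have key : ∀ (S : Finset (Fin m)) (s : Fin m →₀ ℕ),
      (∏ i ∈ S, (Polynomial.C (x i) + Polynomial.X * Polynomial.C (y i)) ^ s i).natDegree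
        ≤ ∑ i ∈ S, s i ∧
      (∏ i ∈ S, (Polynomial.C (x i) + Polynomial.X * Polynomial.C (y i)) ^ s i).coeff
        (∑ i ∈ S, s i) = ∏ i ∈ S, y i ^ s i := by
    intro S s
    have hl : ∀ i, (Polynomial.C (x i) + Polynomial.X * Polynomial.C (y i)).natDegree ≤ 1 := by
      intro i; compute_degree
    have hl2 : ∀ i, ((Polynomial.C (x i) + Polynomial.X * Polynomial.C (y i)) ^ s i).natDegree
        ≤ s i := by
      intro i
      simpa using Polynomial.natDegree_pow_le_of_le (s i) (hl i)
    induction S using Finset.induction_on with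
    | empty => simp
    | insert a S ha ih =>
      rw [Finset.prod_insert ha, Finset.sum_insert ha, Finset.prod_insert ha]
      refine ⟨Polynomial.natDegree_mul_le_of_le (hl2 a) ih.1, ?_⟩
      rw [Polynomial.coeff_mul_add_eq_of_natDegree_le (hl2 a) ih.1, ih.2]
      congr 1
      have := Polynomial.coeff_pow_of_natDegree_le (m := s a) (hl a)
      rw [mul_one] at this
      rw [this]
      simp [Polynomial.coeff_C]
  rw [aeval_def, aeval_def, eval₂_eq', eval₂_eq', Polynomial.finsetSum_coeff]
  refine Finset.sum_congr rfl fun s hs => ?_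
  have hdeg : ∑ i, s i = e := by
    have := hp (mem_support_iff.1 hs)
    rw [Finsupp.weight_apply, Finsupp.sum_fintype _ _ (by simp)] at this
    simpa using this
  rw [Polynomial.algebraMap_apply, Polynomial.coeff_C_mul, ← hdeg, (key _ s).2]

lemma aux_core {E : Type} [Field E] (n : ℕ) (G : Fin (n+1) → Polynomial E)
    (hG : Ideal.span (Set.range G) = ⊤) (x y : Fin (n+1) → E)
    (hxy : LinearIndependent E ![x, y])
    (hx : ∑ i, Polynomial.C (x i) * G i = 0) (hy : ∑ i, Polynomial.C (y i) * G i = 0)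
    (hw : ∀ v : Fin (n+1) → E, ∑ i, v i * (G i).eval 0 = 0 → ∃ w : Fin (n+1) → E,
      ∑ i, (Polynomial.C (v i) + Polynomial.X * Polynomial.C (w i)) * G i = 0) (i : Fin (n+1)) :
    (G i).natDegree ≤ n - 2 := by
  classical
  obtain ⟨r0, hr0⟩ : ∃ r0 : Fin (n+1) → Polynomial E, ∑ i, r0 i * G i = 1 := by
    have : (1 : Polynomial E) ∈ Ideal.span (Set.range G) := by rw [hG]; trivial
    obtain ⟨c, hc⟩ := Ideal.mem_span_range_iff_exists_fun.1 this
    exact ⟨c, hc⟩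
  let φ : (Fin (n+1) → E) →ₗ[E] E := ∑ i, (G i).eval 0 • LinearMap.proj i
  have hφ : ∀ v, φ v = ∑ i, v i * (G i).eval 0 := fun v => by simp [φ, mul_comm]
  have ev : ∀ r : Fin (n+1) → Polynomial E, φ (fun i => (r i).eval 0) = (∑ i, r i * G i).eval 0 := by
    intro r; simp [hφ, Polynomial.eval_finsetSum]
  let c0 : Fin (n+1) → E := fun i => (r0 i).eval 0
  have hc0 : φ c0 = 1 := by rw [ev, hr0]; simp
  have hxU : φ x = 0 := by simpa [hx] using ev (fun i => Polynomial.C (x i))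
  have hyU : φ y = 0 := by simpa [hy] using ev (fun i => Polynomial.C (y i))
  let U := LinearMap.ker φ
  have hU : Module.finrank E U = n := by
    have h1 := LinearMap.finrank_range_add_finrank_ker φ
    have h2 : LinearMap.range φ = ⊤ := by
      rw [LinearMap.range_eq_top]
      intro a; exact ⟨a • c0, by simp [hc0]⟩
    rw [h2, finrank_top] at h1
    simp at h1
    change Module.finrank E φ.ker = n
    omega
  let x' : U := ⟨x, hxU⟩
  let y' : U := ⟨y, hyU⟩
  have hxy' : LinearIndependent E ![x', y'] := by
    apply LinearIndependent.of_comp U.subtype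
    convert hxy using 1
    ext j; fin_cases j <;> rfl
  have hne : x' ≠ y' := by
    intro h
    have := hxy'.injective (a₁ := 0) (a₂ := 1) (by simpa using h)
    simp at this
  have hs : LinearIndepOn E id (Set.range ![x', y']) := hxy'.linearIndepOn_id
  let S := hs.extend (Set.subset_univ _)
  let b : Module.Basis S E U := Module.Basis.extend hs
  have hb : ∀ s, b s = (s : U) := fun s => by simp [b, S]
  have hsub : Set.range ![x', y'] ⊆ S := hs.subset_extend _
  let sx : S := ⟨x', hsub ⟨0, rfl⟩⟩
  let sy : S := ⟨y', hsub ⟨1, rfl⟩⟩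
  have hsne : sx ≠ sy := fun h => hne (congrArg Subtype.val h)
  have : Finite S := Module.Finite.finite_basis b
  let _ : Fintype S := Fintype.ofFinite S
  have hcard : Fintype.card S = n := (Module.finrank_eq_card_basis b).symm.trans hU
  have hw' : ∀ s : S, ∃ w : Fin (n+1) → E,
      (∑ i, (Polynomial.C ((s : U).1 i) + Polynomial.X * Polynomial.C (w i)) * G i = 0) ∧
      (s = sx ∨ s = sy → w = 0) := by
    intro s
    by_cases h : s = sx ∨ s = sy
    · refine ⟨0, ?_, fun _ => rfl⟩
      rcases h with rfl | rfl
      · simpa using hx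
      · simpa using hy
    · obtain ⟨w, hw⟩ := hw (s : U).1 (by rw [← hφ]; exact (s : U).2)
      exact ⟨w, hw, fun h' => absurd h' h⟩
  choose w hw1 hw2 using hw'
  let r : Option S → Fin (n+1) → Polynomial E := fun a => a.elim r0
    (fun s i => Polynomial.C ((s : U).1 i) + Polynomial.X * Polynomial.C (w s i))
  have e : Option S ≃ Fin (n+1) := Fintype.equivOfCardEq (by simp [hcard])
  let N : Matrix (Option S) (Option S) (Polynomial E) := fun a b => r a (e b)
  have hN : N.mulVec (G ∘ e) = Pi.single none 1 := by
    ext1 a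
    have : N.mulVec (G ∘ e) a = ∑ i, r a i * G i := by
      simp only [Matrix.mulVec, dotProduct, N, Function.comp]
      exact e.sum_comp (fun i => r a i * G i)
    rw [this]
    cases a with
    | none => simpa [r] using hr0
    | some s => simpa [r] using hw1 s
  have hadj : ∀ b, N.det * G (e b) = N.adjugate b none := by
    intro b
    have h1 : (N.adjugate * N).mulVec (G ∘ e) = N.adjugate.mulVec (Pi.single none 1) := by
      rw [← Matrix.mulVec_mulVec, hN]
    rw [Matrix.adjugate_mul] at h1
    have := congrFun h1 b
    simpa [Matrix.smul_mulVec] using this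
  have hdet : N.det ≠ 0 := by
    intro h0
    let M : Matrix (Option S) (Option S) E := (Polynomial.evalRingHom 0).mapMatrix N
    have hM : M.det = 0 := by
      rw [← RingHom.map_det, h0, map_zero]
    let u : Option S → Fin (n+1) → E := fun a => a.elim c0 (fun s => (s : U).1)
    have hu : LinearIndependent E u := by
      rw [linearIndependent_option]
      constructor
      · have : u ∘ some = U.subtype ∘ b := by
          ext1 s; simp [u, hb]
        change LinearIndependent E (u ∘ some)
        rw [this]
        exact b.linearIndependent.map' _ (Submodule.ker_subtype _)
      · intro hmem
        have : Submodule.span E (Set.range (fun s : S => u (some s))) ≤ U := by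
          rw [Submodule.span_le]
          rintro _ ⟨s, rfl⟩
          exact (s : U).2
        have h1 : φ c0 = 0 := this hmem
        rw [hc0] at h1
        exact one_ne_zero h1
    have hu2 : LinearIndependent E (fun a => M a) := by
      have h3 := hu.map' (LinearEquiv.funCongrLeft E E e).toLinearMap (LinearEquiv.ker _)
      have h4 : (fun a => M a) = (LinearEquiv.funCongrLeft E E e).toLinearMap ∘ u := by
        funext a b
        change (r a (e b)).eval 0 = u a (e b)
        cases a <;> simp [r, u, c0]
      rw [h4]
      exact h3
    have := (Matrix.linearIndependent_rows_iff_isUnit (A := M)).1 hu2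
    rw [Matrix.isUnit_iff_isUnit_det, hM] at this
    exact not_isUnit_zero this
  have hdeg : ∀ b, (N.adjugate b none).natDegree ≤ n - 2 := by
    intro b
    let δ : Option S → ℕ := fun a => if a = none ∨ a = some sx ∨ a = some sy then 0 else 1
    have hδ : ∑ a, δ a = n - 2 := by
      rw [Fintype.sum_option]
      have : ∑ s : S, δ (some s) = (Finset.univ \ {sx, sy}).card := by
        rw [Finset.card_eq_sum_ones, ← Finset.sum_subset (Finset.subset_univ (Finset.univ \ {sx, sy}))]
        · refine Finset.sum_congr rfl fun s hs => ?_
          simp at hs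
          simp [δ, hs]
        · intro s _ hs
          simp at hs
          simp only [δ]
          rw [if_pos]
          tauto
      rw [this, Finset.card_sdiff_of_subset (Finset.subset_univ _), Finset.card_pair hsne]
      simp [δ, hcard]
    rw [Matrix.adjugate_apply, Matrix.det_apply]
    refine Polynomial.natDegree_sum_le_of_forall_le _ _ fun σ _ => ?_
    refine (Polynomial.natDegree_smul_le _ _).trans ?_
    refine (Polynomial.natDegree_prod_le _ _).trans ?_
    rw [← hδ, ← Equiv.sum_comp σ δ]
    refine Finset.sum_le_sum fun a _ => ?_
    generalize σ a = c
    cases c with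
    | none =>
      simp only [Matrix.updateRow_self, Pi.single_apply]
      split_ifs <;> simp
    | some s =>
      rw [Matrix.updateRow_ne (by simp)]
      simp only [N, r, Option.elim]
      by_cases h : s = sx ∨ s = sy
      · rw [hw2 s h]; simp
      · have : δ (some s) = 1 := by simp [δ]; tauto
        rw [this]
        compute_degree
  have h1 := hdeg (e.symm i)
  rw [← hadj, e.apply_symm_apply] at h1
  by_cases hGi : G i = 0
  · simp [hGi]
  rw [Polynomial.natDegree_mul hdet hGi] at h1
  omega

lemma aux_point {K : Type} [Field K] {m : ℕ} (F : MvPolynomial (Fin m) K) (k : Fin m)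
    (x : Fin m → K) (hxk : x k ≠ 0) (W : Submodule K (Fin m → K))
    (hW : Module.finrank K W = 2) (hxW : x ∈ W) (hFW : ∀ w ∈ W, eval w F = 0) :
    ∃ j, ∃ y : Fin m → K, y k = 0 ∧ y j = 1 ∧ ∀ t : K, eval (x + t • y) F = 0 := by
  have h1 : ¬ W ≤ K ∙ x := by
    intro h
    have h2 := Submodule.finrank_mono h
    have h3 := finrank_span_singleton (K := K) (v := x) (by rintro rfl; simp at hxk)
    omega
  obtain ⟨w, hw, hwx⟩ := SetLike.not_le_iff_exists.1 h1
  let y0 := w - (w k / x k) • x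
  have hy0 : y0 ∈ W := W.sub_mem hw (W.smul_mem _ hxW)
  have hy0k : y0 k = 0 := by simp [y0, hxk]
  have hy0ne : y0 ≠ 0 := by
    intro h
    exact hwx (Submodule.mem_span_singleton.2 ⟨w k / x k, (sub_eq_zero.1 h).symm⟩)
  obtain ⟨j, hj⟩ := Function.ne_iff.1 hy0ne
  refine ⟨j, (y0 j)⁻¹ • y0, by simp [hy0k], by simpa using inv_mul_cancel₀ hj, fun t => ?_⟩
  exact hFW _ (W.add_mem hxW (W.smul_mem _ (W.smul_mem _ hy0)))

lemma aux_generic {K : Type} [Field K] [IsAlgClosed K] {m : ℕ} (F P : MvPolynomial (Fin m) K)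
    (hP : Prime P) (hPF : P ∣ F) (k : Fin m) (hk : ¬ P ∣ X k)
    (H : ∀ x : Fin m → K, x ≠ 0 → eval x F = 0 → ∃ W : Submodule K (Fin m → K),
      Module.finrank K W = 2 ∧ x ∈ W ∧ ∀ w ∈ W, eval w F = 0) :
    ∃ (E : Type) (_ : Field E) (_ : Algebra K E) (x y : Fin m → E),
      (∀ g, aeval x g = 0 ↔ P ∣ g) ∧ y k = 0 ∧ y ≠ 0 ∧
      ∀ t : K, aeval (fun i => x i + algebraMap K E t * y i) F = 0 := by
  have hprime : (Ideal.span {P}).IsPrime := (Ideal.span_singleton_prime hP.ne_zero).2 hP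
  have hae : ∀ (x : Fin m → K) p, aeval x p = eval x p := fun x p => by
    rw [← coe_aeval_eq_eval]; rfl
  let ι : MvPolynomial (Fin m) K →ₐ[K] (MvPolynomial (Fin m ⊕ Fin m) K) := rename Sum.inl
  let gen : Fin m → Set (MvPolynomial (Fin m ⊕ Fin m) K) := fun j => {ι P, X (Sum.inr k), X (Sum.inr j) - 1} ∪
    Set.range (fun t : K => aeval (fun i => (X (Sum.inl i) + C t * X (Sum.inr i) : (MvPolynomial (Fin m ⊕ Fin m) K))) F)
  let J : Fin m → Ideal (MvPolynomial (Fin m ⊕ Fin m) K) := fun j => Ideal.span (gen j)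
  let S : Submonoid (MvPolynomial (Fin m ⊕ Fin m) K) := (Ideal.span {P}).primeCompl.map ι
  have hex : ∃ j, Disjoint (J j : Set (MvPolynomial (Fin m ⊕ Fin m) K)) S := by
    by_contra! hcon
    have : ∀ j, ∃ g, ¬ P ∣ g ∧ ι g ∈ J j := by
      intro j
      obtain ⟨_, h1, g, hg, rfl⟩ := Set.not_disjoint_iff.1 (hcon j)
      refine ⟨g, ?_, h1⟩
      rw [← Ideal.mem_span_singleton]; exact hg
    choose g hg hgJ using this
    have hprod : ¬ P ∣ X k * ∏ j, g j := by
      intro h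
      rcases hP.dvd_or_dvd h with h | h
      · exact hk h
      · obtain ⟨j, _, hj⟩ := (hP.dvd_finsetProd_iff _).1 h
        exact hg j hj
    have hnull : ∃ x : Fin m → K, eval x P = 0 ∧ eval x (X k * ∏ j, g j) ≠ 0 := by
      by_contra! hall
      apply hprod
      rw [← Ideal.mem_span_singleton,
        ← IsPrime.vanishingIdeal_zeroLocus (K := K) (Ideal.span {P}), mem_vanishingIdeal_iff]
      intro x hx
      rw [mem_zeroLocus_iff] at hx
      have := hall x (by
        have := hx P (Ideal.mem_span_singleton_self P)
        rwa [hae] at this)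
      rw [hae]; exact this
    obtain ⟨x, hxP, hx⟩ := hnull
    rw [map_mul, eval_X, map_prod] at hx
    have hxk : x k ≠ 0 := left_ne_zero_of_mul hx
    have hxg := Finset.prod_ne_zero_iff.1 (right_ne_zero_of_mul hx)
    obtain ⟨q, rfl⟩ := hPF
    obtain ⟨W, hW, hxW, hFW⟩ := H x (by rintro rfl; simp at hxk) (by simp [hxP])
    obtain ⟨j, y, hyk, hyj, hy⟩ := aux_point _ k x hxk W hW hxW hFW
    apply hxg j (Finset.mem_univ _)
    let ev : (MvPolynomial (Fin m ⊕ Fin m) K) →ₐ[K] K := aeval (Sum.elim x y)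
    have hJ : J j ≤ RingHom.ker ev := by
      rw [Ideal.span_le]
      rintro f ((rfl | rfl | rfl) | ⟨t, rfl⟩)
      · simp only [SetLike.mem_coe, RingHom.mem_ker, ev, ι, aeval_rename]
        rw [← hxP, ← hae]; rfl
      · simp [RingHom.mem_ker, ev, hyk]
      · simp [RingHom.mem_ker, ev, hyj]
      · simp only [SetLike.mem_coe, RingHom.mem_ker]
        rw [← AlgHom.comp_apply, comp_aeval, hae]
        convert hy t using 3
        ext i
        simp [ev]
    have := hJ (hgJ j)
    simp only [RingHom.mem_ker, ev, ι, aeval_rename] at this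
    rw [← hae, ← this]; rfl
  obtain ⟨j, hj⟩ := hex
  obtain ⟨q, hq, hJq, hqS⟩ := Ideal.exists_le_prime_disjoint _ _ hj
  let E := FractionRing ((MvPolynomial (Fin m ⊕ Fin m) K) ⧸ q)
  let π : (MvPolynomial (Fin m ⊕ Fin m) K) →ₐ[K] E := (IsScalarTower.toAlgHom K ((MvPolynomial (Fin m ⊕ Fin m) K) ⧸ q) E).comp (Ideal.Quotient.mkₐ K q)
  have hπ : ∀ f, π f = 0 ↔ f ∈ q := by
    intro f
    change algebraMap ((MvPolynomial (Fin m ⊕ Fin m) K) ⧸ q) E (Ideal.Quotient.mk q f) = 0 ↔ _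
    rw [FaithfulSMul.algebraMap_eq_zero_iff, Ideal.Quotient.eq_zero_iff_mem]
  have hgen : ∀ f ∈ gen j, π f = 0 := fun f hf => (hπ f).2 (hJq (Ideal.subset_span hf))
  have hπι : ∀ g, aeval (fun i => π (X (Sum.inl i))) g = π (ι g) := by
    intro g
    have : (aeval (fun i => π (X (Sum.inl i))) : MvPolynomial (Fin m) K →ₐ[K] E) = π.comp ι := by
      ext i; simp [ι]
    rw [this]; rfl
  refine ⟨E, inferInstance, inferInstance, fun i => π (X (Sum.inl i)), fun i => π (X (Sum.inr i)),
    ?_, ?_, ?_, ?_⟩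
  · intro g
    rw [hπι]
    constructor
    · intro h
      by_contra hg
      refine Set.disjoint_left.1 hqS ((hπ _).1 h) ⟨g, ?_, rfl⟩
      intro h'
      exact hg (Ideal.mem_span_singleton.1 h')
    · rintro ⟨r, rfl⟩
      rw [map_mul, map_mul, hgen _ (by simp [gen]), zero_mul]
  · exact hgen _ (by simp [gen])
  · intro h
    have h1 := hgen (X (Sum.inr j) - 1) (by simp [gen])
    have h2 := congrFun h j
    simp only [Pi.zero_apply] at h2
    rw [map_sub, h2, map_one, zero_sub, neg_eq_zero] at h1
    exact one_ne_zero h1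
  · intro t
    have h1 := hgen _ (Or.inr ⟨t, rfl⟩)
    rw [← AlgHom.comp_apply, comp_aeval] at h1
    rw [← h1]
    congr 2
    funext i
    rw [map_add, map_mul]
    congr 2

/-- A smooth hypersurface `X = {F = 0} ⊂ P^n` of degree `d ≥ n` (with `n ≥ 2`) is not swept
out by lines: there is a nonzero `x ∈ K^{n+1}` with `F(x) = 0` such that no 2-dimensional
linear subspace `W ⊆ K^{n+1}` containing `x` has `F` vanishing identically on `W`. -/
theorem smooth_high_degree_not_swept_by_lines {K : Type} [Field K] [IsAlgClosed K]
    [CharZero K] (n d : ℕ) (hn : 2 ≤ n) (hd : n ≤ d)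
    (F : MvPolynomial (Fin (n+1)) K) (hF : F.IsHomogeneous d)
    (hsmooth : ∀ x : Fin (n+1) → K,
      (∀ i, MvPolynomial.eval x (MvPolynomial.pderiv i F) = 0) → x = 0) :
    ∃ x : Fin (n+1) → K, x ≠ 0 ∧ MvPolynomial.eval x F = 0 ∧
      ¬ ∃ W : Submodule K (Fin (n+1) → K), Module.finrank K W = 2 ∧ x ∈ W ∧
        ∀ w ∈ W, MvPolynomial.eval w F = 0 := by
  by_contra! H
  have hF0 : F ≠ 0 := by
    rintro rfl
    have := congrFun (hsmooth 1 (by simp)) 0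
    simp at this
  have hFu : ¬ IsUnit F := by
    intro hu
    have h1 : F.totalDegree = 0 := (isUnit_iff_totalDegree_of_isReduced.1 hu).2
    have h2 := hF.totalDegree hF0
    omega
  obtain ⟨P, hPirr, hPF⟩ := WfDvdMonoid.exists_irreducible_factor hFu hF0
  have hP : Prime P := hPirr.prime
  obtain ⟨k, hk⟩ : ∃ k : Fin (n+1), ¬ P ∣ X k := by
    by_contra! hall
    let a : Fin (n+1) := ⟨0, by omega⟩
    let b : Fin (n+1) := ⟨1, by omega⟩
    have h1 : Associated P (X a) := hPirr.associated_of_dvd (X_prime (R := K) (i := a)).irreducible (hall a)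
    have h2 : (X a : MvPolynomial (Fin (n+1)) K) ∣ X b := h1.symm.dvd.trans (hall b)
    rw [X_dvd_X] at h2
    simp [a, b] at h2
  obtain ⟨E, _, _, x, y, hx, hyk, hy0, hline⟩ := aux_generic F P hP hPF k hk H
  have hxk : x k ≠ 0 := by
    intro h
    exact hk ((hx _).1 (by simpa using h))
  -- smoothness over K-algebras
  have hnull : ∀ j, ∃ N : ℕ, (X j : MvPolynomial (Fin (n+1)) K) ^ N ∈
      Ideal.span (Set.range fun i => pderiv i F) := by
    intro j
    change X j ∈ (Ideal.span (Set.range fun i => pderiv i F)).radical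
    rw [← vanishingIdeal_zeroLocus_eq_radical (K := K), mem_vanishingIdeal_iff]
    intro z hz
    rw [zeroLocus_span] at hz
    have : z = 0 := hsmooth z fun i => by
      have := hz _ ⟨i, rfl⟩
      rw [← coe_aeval_eq_eval]; exact this
    simp [this]
  have hsm : ∀ (B : Type) [CommRing B] [Algebra K B] (I : Ideal B) (z : Fin (n+1) → B),
      I.IsPrime → (∀ i, aeval z (pderiv i F) ∈ I) → ∀ j, z j ∈ I := by
    intro B _ _ I z hI hz j
    obtain ⟨N, hN⟩ := hnull j
    have : Ideal.span (Set.range fun i => pderiv i F) ≤ I.comap (aeval (R := K) z) := by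
      rw [Ideal.span_le]
      rintro _ ⟨i, rfl⟩
      exact hz i
    have h1 := this hN
    rw [Ideal.mem_comap, map_pow, aeval_X] at h1
    exact hI.mem_of_pow_mem _ h1
  let z : Fin (n+1) → Polynomial E :=
    fun i => Polynomial.C (x i) + Polynomial.X * Polynomial.C (y i)
  let G : Fin (n+1) → Polynomial E := fun i => aeval z (pderiv i F)
  have hev : ∀ (t : E) (p : MvPolynomial (Fin (n+1)) K),
      (aeval z p).eval t = aeval (fun i => x i + t * y i) p := by
    intro t p
    have : (Polynomial.aeval t : Polynomial E →ₐ[E] E).restrictScalars K (aeval z p)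
        = aeval (fun i => x i + t * y i) p := by
      rw [← AlgHom.comp_apply, comp_aeval]
      congr 2
      funext i
      simp [z]
      ring
    rw [← this]
    simp [Polynomial.coe_aeval_eq_eval]
  have hzero : ∀ p : Polynomial E, (∀ t : K, p.eval (algebraMap K E t) = 0) → p = 0 := by
    intro p hp
    refine Polynomial.eq_zero_of_infinite_isRoot p ?_
    refine (Set.infinite_range_of_injective (algebraMap K E).injective).mono ?_
    rintro _ ⟨t, rfl⟩
    exact hp t
  have hFz : aeval z F = 0 := hzero _ fun t => by rw [hev]; exact hline t
  have hEuler : ∑ i, z i * G i = 0 := by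
    have h1 := congrArg (aeval z) hF.sum_X_mul_pderiv
    simpa [hFz, G] using h1
  have hyG : ∑ i, Polynomial.C (y i) * G i = 0 := by
    let D : Derivation K (Polynomial E) (Polynomial E) :=
      (Polynomial.derivative' (R := E)).restrictScalars K
    have h1 := aux_chain D z F
    rw [hFz, map_zero] at h1
    rw [h1]
    refine Finset.sum_congr rfl fun i _ => ?_
    have : D (z i) = Polynomial.C (y i) := by
      change Polynomial.derivative (z i) = _
      simp [z]
    rw [this, mul_comm]
  have hxG : ∑ i, Polynomial.C (x i) * G i = 0 := by
    have h1 : ∑ i, z i * G i = ∑ i, Polynomial.C (x i) * G i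
        + Polynomial.X * ∑ i, Polynomial.C (y i) * G i := by
      rw [Finset.mul_sum, ← Finset.sum_add_distrib]
      refine Finset.sum_congr rfl fun i _ => ?_
      simp only [z]; ring
    rw [hEuler, hyG, mul_zero, add_zero] at h1
    exact h1.symm
  have hGtop : Ideal.span (Set.range G) = ⊤ := by
    by_contra hne
    obtain ⟨M, hM, hle⟩ := Ideal.exists_le_maximal _ hne
    have h1 := hsm _ M z hM.isPrime (fun i => hle (Ideal.subset_span ⟨i, rfl⟩)) k
    refine hM.ne_top (Ideal.eq_top_of_isUnit_mem _ h1 ?_)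
    simp only [z, hyk, map_zero, mul_zero, add_zero]
    exact Polynomial.isUnit_C.2 (isUnit_iff_ne_zero.2 hxk)
  have hli : LinearIndependent E ![x, y] := by
    rw [LinearIndependent.pair_iff]
    intro s t hst
    have h1 := congrFun hst k
    simp [hyk, hxk] at h1
    refine ⟨h1, ?_⟩
    rw [h1, zero_smul, zero_add] at hst
    exact (smul_eq_zero.1 hst).resolve_right hy0
  have hG0 : ∀ i, (G i).eval 0 = aeval x (pderiv i F) := by
    intro i
    simp [G, hev]
  obtain ⟨Q, hQ⟩ := hPF
  have hxP : aeval x P = 0 := (hx P).2 dvd_rfl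
  have hpd : ∀ i, aeval x (pderiv i F) = aeval x Q * aeval x (pderiv i P) := by
    intro i
    rw [hQ, Derivation.leibniz, map_add, smul_eq_mul, smul_eq_mul, map_mul, map_mul, hxP]
    ring
  have hQ0 : aeval x Q ≠ 0 := by
    intro h
    have := hsm E ⊥ x Ideal.isPrime_bot (fun i => by simp [hpd, h]) k
    exact hxk (by simpa using this)
  have hw : ∀ v : Fin (n+1) → E, ∑ i, v i * (G i).eval 0 = 0 → ∃ w : Fin (n+1) → E,
      ∑ i, (Polynomial.C (v i) + Polynomial.X * Polynomial.C (w i)) * G i = 0 := by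
    intro v hv
    have hv' : ∑ i, aeval x (pderiv i P) * v i = 0 := by
      have : aeval x Q * ∑ i, aeval x (pderiv i P) * v i = 0 := by
        rw [← hv, Finset.mul_sum]
        refine Finset.sum_congr rfl fun i _ => ?_
        rw [hG0, hpd]; ring
      exact (mul_eq_zero.1 this).resolve_left hQ0
    obtain ⟨D, hD⟩ := aux_der x P hx v hv'
    refine ⟨fun i => D (y i), hzero _ fun t => ?_⟩
    have h1 := aux_chain D (fun i => x i + algebraMap K E t * y i) F
    rw [hline, map_zero] at h1
    rw [Polynomial.eval_finsetSum, h1]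
    refine Finset.sum_congr rfl fun i _ => ?_
    simp only [G, Polynomial.eval_mul, hev, map_add, hD, Derivation.leibniz, Derivation.map_algebraMap]
    simp
    ring
  have hdeg := aux_core n G hGtop x y hli hxG hyG hw
  apply hy0
  funext j
  have := hsm E ⊥ y Ideal.isPrime_bot (fun i => ?_) j
  · simpa using this
  · rw [Ideal.mem_bot, ← aux_coeff x y (d-1) _ hF.pderiv]
    exact Polynomial.coeff_eq_zero_of_natDegree_lt (lt_of_le_of_lt (hdeg i) (by omega))
end

section
/- Let F ∈ K[x_0,…,x_n] be homogeneous of degree d ≥ 1 and let a = (a_0,…,a_n) and b = (b_0,…,b_n) be tuples of linear forms in K[s,t] with F(a) ≠ 0. Then the ideal of the dual numbers (K[s,t])[ε] generated by F(a + εb) equals the ideal generated by F(a) if and only if F(a) divides ∑_{i=0}^n b_i · (∂F/∂x_i)(a) in K[s,t]. (The ideal equality says that the first-order deformation ι_ε of the line ι preserves the subscheme ι^{-1}(X) for X = {F = 0}; the divisibility condition characterizes the tuples (b_0,…,b_n) representing global sections of the restricted logarithmic tangent sheaf ι*T_{P^n}(−log X).) -/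
theorem aeval_dual_fst_snd {K : Type} [Field K] {m : ℕ}
    (F : MvPolynomial (Fin m) K) (a b : Fin m → MvPolynomial (Fin 2) K) :
    (MvPolynomial.aeval
        (fun i => (TrivSqZeroExt.inl (a i) + TrivSqZeroExt.inl (b i) * DualNumber.eps :
          DualNumber (MvPolynomial (Fin 2) K))) F).fst = MvPolynomial.aeval a F ∧
    (MvPolynomial.aeval
        (fun i => (TrivSqZeroExt.inl (a i) + TrivSqZeroExt.inl (b i) * DualNumber.eps :
          DualNumber (MvPolynomial (Fin 2) K))) F).snd =
      ∑ i, b i * MvPolynomial.aeval a (MvPolynomial.pderiv i F) := by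
  induction F using MvPolynomial.induction_on with
  | C r =>
    simp only [MvPolynomial.aeval_C, MvPolynomial.pderiv_C, map_zero, mul_zero,
      Finset.sum_const_zero]
    exact ⟨rfl, by simp [TrivSqZeroExt.algebraMap_eq_inl']⟩
  | add p q hp hq =>
    simp only [map_add, TrivSqZeroExt.fst_add, TrivSqZeroExt.snd_add, hp.1, hp.2, hq.1, hq.2,
      mul_add, Finset.sum_add_distrib, and_self]
  | mul_X p j hp =>
    refine ⟨by simp [hp.1], ?_⟩
    rw [map_mul, DualNumber.snd_mul, hp.1, hp.2]
    simp only [MvPolynomial.aeval_X, MvPolynomial.pderiv_mul, map_add, map_mul,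
      MvPolynomial.pderiv_X, mul_add, Finset.sum_add_distrib]
    rw [Finset.sum_eq_single j (f := fun i => b i * (MvPolynomial.aeval a p * _))]
    · simp [Finset.sum_mul]
      simp only [mul_assoc]
      ring
    · intro i _ hij
      simp [Pi.single_apply, hij.symm]
    · simp

/-- **Deformations preserving `ι⁻¹(X)` and the log tangent sheaf** (coordinate form).
Let `F ∈ K[x_0,…,x_n]` be homogeneous of degree `d ≥ 1` and let `a`, `b` be tuples of
linear forms in `K[s,t]` (here `K[s,t] = MvPolynomial (Fin 2) K`) with `F(a) ≠ 0`. Then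
the ideal of the dual numbers `(K[s,t])[ε]` generated by `F(a + εb)` equals the ideal
generated by `F(a)` if and only if `F(a)` divides `∑ b_i · (∂F/∂x_i)(a)` in `K[s,t]`. -/
theorem deformation_preserves_preimage_iff {K : Type} [Field K] [CharZero K]
    (n d : ℕ) (hn : 1 ≤ n) (hd : 1 ≤ d)
    (F : MvPolynomial (Fin (n+1)) K) (hF : F.IsHomogeneous d)
    (a b : Fin (n+1) → MvPolynomial (Fin 2) K)
    (ha : ∀ i, (a i).IsHomogeneous 1) (hb : ∀ i, (b i).IsHomogeneous 1)
    (hFa : MvPolynomial.aeval a F ≠ 0) :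
    Ideal.span {MvPolynomial.aeval
        (fun i => (TrivSqZeroExt.inl (a i) + TrivSqZeroExt.inl (b i) * DualNumber.eps :
          DualNumber (MvPolynomial (Fin 2) K))) F} =
      Ideal.span {(TrivSqZeroExt.inl (MvPolynomial.aeval a F) :
        DualNumber (MvPolynomial (Fin 2) K))} ↔
    MvPolynomial.aeval a F ∣ ∑ i, b i * MvPolynomial.aeval a (MvPolynomial.pderiv i F) := by
  obtain ⟨h1, h2⟩ := aeval_dual_fst_snd F a b
  rw [← h2]
  generalize (MvPolynomial.aeval
        (fun i => (TrivSqZeroExt.inl (a i) + TrivSqZeroExt.inl (b i) * DualNumber.eps :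
          DualNumber (MvPolynomial (Fin 2) K))) F) = P at h1 h2 ⊢
  generalize MvPolynomial.aeval a F = f at h1 ⊢
  constructor
  · intro h
    have hm : P ∈ Ideal.span {(TrivSqZeroExt.inl f : DualNumber (MvPolynomial (Fin 2) K))} :=
      h ▸ Ideal.mem_span_singleton_self P
    obtain ⟨z, hz⟩ := Ideal.mem_span_singleton.1 hm
    exact ⟨z.snd, by rw [hz, DualNumber.snd_mul]; simp⟩
  · rintro ⟨c, hc⟩
    apply le_antisymm
    · rw [Ideal.span_singleton_le_span_singleton]
      refine ⟨TrivSqZeroExt.inl 1 + TrivSqZeroExt.inr c, ?_⟩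
      apply TrivSqZeroExt.ext
      · simp [h1]
      · rw [DualNumber.snd_mul]; simp [hc]
    · rw [Ideal.span_singleton_le_span_singleton]
      refine ⟨TrivSqZeroExt.inl 1 + TrivSqZeroExt.inr (-c), ?_⟩
      apply TrivSqZeroExt.ext
      · simp [h1]
      · rw [DualNumber.snd_mul]; simp [hc, h1]
end

section
/- Suppose 1 ≤ k ≤ d, F(a) ≠ 0 and s^k divides F(a) (the line meets X = {F = 0} at p = [1:0:⋯:0] to order at least k). Then for every tuple b = (b_0,…,b_n) of linear forms in K[s,t] the following are equivalent: (i) s^k divides F(a + εb) in the dual numbers (K[s,t])[ε] (i.e., the first-order deformation ι_ε preserves order-k contact at [s:t] = [0:1]); (ii) s^k divides ∑_{i=0}^n b_i · (∂F/∂x_i)(a) in K[s,t]; (iii) s^k divides ∑_{i=0}^n b_i · (∂F_k/∂x_i)(a) in K[s,t]. (The equivalence of (i) and (iii) identifies first-order deformations preserving order-k contact with global sections of ι*T_{P^n}(−log X_k).) -/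
open MvPolynomial in
lemma aux_dvd {K R : Type} [Field K] [CommRing R] [Algebra K R] {n j : ℕ}
    (p : MvPolynomial (Fin n) K) (hp : p.IsHomogeneous j) (c : Fin n → R) (s : R)
    (hc : ∀ i, s ∣ c i) : s ^ j ∣ aeval c p := by
  choose e he using hc
  rw [MvPolynomial.aeval_def, MvPolynomial.eval₂_eq]
  refine Finset.dvd_sum fun m hm => Dvd.dvd.mul_left ?_ _
  have h := hp (MvPolynomial.mem_support_iff.mp hm)
  have h2 : ∑ i ∈ m.support, m i = j := by
    rw [← h, Finsupp.weight_apply, Finsupp.sum]; simp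
  rw [← h2, ← Finset.prod_pow_eq_pow_sum]
  exact Finset.prod_dvd_prod_of_dvd _ _ fun i _ => pow_dvd_pow_of_dvd ⟨e i, he i⟩ _

open MvPolynomial in
lemma aux_D_mul {K R : Type} [Field K] [CommRing R] [Algebra K R] {n : ℕ}
    (a b : Fin n → R) (p q : MvPolynomial (Fin n) K) :
    ∑ i, b i * aeval a (pderiv i (p * q)) =
      (∑ i, b i * aeval a (pderiv i p)) * aeval a q +
        aeval a p * (∑ i, b i * aeval a (pderiv i q)) := by
  rw [Finset.sum_mul, Finset.mul_sum, ← Finset.sum_add_distrib]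
  refine Finset.sum_congr rfl fun i _ => ?_
  rw [pderiv_mul, map_add, map_mul, map_mul]; ring

open MvPolynomial in
lemma aux_D_add {K R : Type} [Field K] [CommRing R] [Algebra K R] {n : ℕ}
    (a b : Fin n → R) (p q : MvPolynomial (Fin n) K) :
    ∑ i, b i * aeval a (pderiv i (p + q)) =
      (∑ i, b i * aeval a (pderiv i p)) + (∑ i, b i * aeval a (pderiv i q)) := by
  simp only [map_add, mul_add, Finset.sum_add_distrib]

open MvPolynomial in
lemma aux_dual {K R : Type} [Field K] [CommRing R] [Algebra K R] {n : ℕ}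
    (a b : Fin n → R) (p : MvPolynomial (Fin n) K) :
    aeval (fun i => (TrivSqZeroExt.inl (a i) + TrivSqZeroExt.inl (b i) * DualNumber.eps :
          DualNumber R)) p =
      TrivSqZeroExt.inl (aeval a p) + TrivSqZeroExt.inr (∑ i, b i * aeval a (pderiv i p)) := by
  induction p using MvPolynomial.induction_on with
  | C r =>
    simp [TrivSqZeroExt.algebraMap_eq_inl']
  | add p q hp hq =>
    rw [aux_D_add, map_add, map_add, hp, hq]
    ext <;> simp
  | mul_X p i hp =>
    have hX : ∑ j, b j * aeval a (pderiv j (X i : MvPolynomial (Fin n) K)) = b i := by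
      rw [Finset.sum_eq_single i]
      · simp
      · intro j _ hj
        rw [pderiv_X_of_ne (Ne.symm hj)]; simp
      · simp
    rw [aux_D_mul, hX, map_mul, map_mul, hp, aeval_X, aeval_X]
    ext
    · simp
    · simp; ring

lemma aux_inl_dvd {R : Type} [CommRing R] (c u v : R) :
    ((TrivSqZeroExt.inl c : DualNumber R) ∣ TrivSqZeroExt.inl u + TrivSqZeroExt.inr v) ↔
      c ∣ u ∧ c ∣ v := by
  constructor
  · rintro ⟨x, hx⟩
    refine ⟨⟨x.fst, ?_⟩, ⟨x.snd, ?_⟩⟩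
    · simpa using congrArg TrivSqZeroExt.fst hx
    · simpa using congrArg TrivSqZeroExt.snd hx
  · rintro ⟨⟨x, rfl⟩, ⟨y, rfl⟩⟩
    refine ⟨TrivSqZeroExt.inl x + TrivSqZeroExt.inr y, ?_⟩
    ext <;> simp

open MvPolynomial in
lemma aux_D_rename {K R : Type} [Field K] [CommRing R] [Algebra K R] {n j : ℕ}
    (p : MvPolynomial (Fin n) K) (hp : p.IsHomogeneous j) (a b : Fin (n+1) → R) (s : R)
    (ha : ∀ i : Fin n, s ∣ a i.succ) :
    s ^ (j - 1) ∣ ∑ i, b i * aeval a (pderiv i (rename Fin.succ p)) := by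
  refine Finset.dvd_sum fun i _ => Dvd.dvd.mul_left ?_ _
  refine Fin.cases ?_ (fun i => ?_) i
  · rw [pderiv_eq_zero_of_notMem_vars]
    · simp
    · intro h
      have := vars_rename Fin.succ p h
      simp at this
  · rw [pderiv_rename (Fin.succ_injective n), aeval_rename]
    exact aux_dvd _ hp.pderiv _ _ ha

/-- **Corollary: deformations preserving order-`k` contact and `ι*T_{P^n}(−log X_k)`.**
With `F = ∑_{j=1}^d x_0^{d−j} f_j` (each `f_j ∈ K[x_1,…,x_n]` homogeneous of degree `j` or
zero), `F_k = ∑_{j=1}^k x_0^{k−j} f_j` its degree-`k` truncation, and `a` a tuple of linear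
forms in `K[s,t]` with `s ∤ a_0`, `s ∣ a_i` for `i ≥ 1`, suppose `1 ≤ k ≤ d`, `F(a) ≠ 0`
and `s^k ∣ F(a)`. Then for every tuple `b` of linear forms:
(i) `s^k ∣ F(a + εb)` in `(K[s,t])[ε]` ↔ (ii) `s^k ∣ ∑ b_i (∂F/∂x_i)(a)`, and
(ii) ↔ (iii) `s^k ∣ ∑ b_i (∂F_k/∂x_i)(a)`.
Here `K[s,t] = MvPolynomial (Fin 2) K` with `s = X 0`. -/
theorem order_k_contact_deformations {K : Type} [Field K] [CharZero K]
    (n d k : ℕ) (hn : 1 ≤ n) (hk1 : 1 ≤ k) (hkd : k ≤ d)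
    (f : ℕ → MvPolynomial (Fin n) K) (hf : ∀ j, (f j).IsHomogeneous j)
    (F Fk : MvPolynomial (Fin (n+1)) K)
    (hF : F = ∑ j ∈ Finset.Icc 1 d,
      MvPolynomial.X 0 ^ (d - j) * MvPolynomial.rename Fin.succ (f j))
    (hFk : Fk = ∑ j ∈ Finset.Icc 1 k,
      MvPolynomial.X 0 ^ (k - j) * MvPolynomial.rename Fin.succ (f j))
    (a : Fin (n+1) → MvPolynomial (Fin 2) K) (ha : ∀ i, (a i).IsHomogeneous 1)
    (ha0 : ¬ (MvPolynomial.X 0 : MvPolynomial (Fin 2) K) ∣ a 0)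
    (hai : ∀ i : Fin (n+1), i ≠ 0 → (MvPolynomial.X 0 : MvPolynomial (Fin 2) K) ∣ a i)
    (hFa : MvPolynomial.aeval a F ≠ 0)
    (hcontact : (MvPolynomial.X 0 : MvPolynomial (Fin 2) K) ^ k ∣ MvPolynomial.aeval a F)
    (b : Fin (n+1) → MvPolynomial (Fin 2) K) (hb : ∀ i, (b i).IsHomogeneous 1) :
    ((TrivSqZeroExt.inl ((MvPolynomial.X 0 : MvPolynomial (Fin 2) K) ^ k) :
        DualNumber (MvPolynomial (Fin 2) K)) ∣
      MvPolynomial.aeval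
        (fun i => (TrivSqZeroExt.inl (a i) + TrivSqZeroExt.inl (b i) * DualNumber.eps :
          DualNumber (MvPolynomial (Fin 2) K))) F ↔
      (MvPolynomial.X 0 : MvPolynomial (Fin 2) K) ^ k ∣
        ∑ i, b i * MvPolynomial.aeval a (MvPolynomial.pderiv i F)) ∧
    ((MvPolynomial.X 0 : MvPolynomial (Fin 2) K) ^ k ∣
        ∑ i, b i * MvPolynomial.aeval a (MvPolynomial.pderiv i F) ↔
      (MvPolynomial.X 0 : MvPolynomial (Fin 2) K) ^ k ∣
        ∑ i, b i * MvPolynomial.aeval a (MvPolynomial.pderiv i Fk)) := by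
  have hs : Prime (MvPolynomial.X 0 : MvPolynomial (Fin 2) K) := MvPolynomial.X_prime
  set s : MvPolynomial (Fin 2) K := MvPolynomial.X 0 with hsdef
  have hai' : ∀ i : Fin n, s ∣ a i.succ := fun i => hai _ (Fin.succ_ne_zero i)
  refine ⟨?_, ?_⟩
  · rw [aux_dual, aux_inl_dvd]
    exact and_iff_right hcontact
  have hFG : F = MvPolynomial.X 0 ^ (d - k) * Fk + ∑ j ∈ Finset.Ioc k d,
      MvPolynomial.X 0 ^ (d - j) * MvPolynomial.rename Fin.succ (f j) := by
    have hu : Finset.Icc 1 d = Finset.Icc 1 k ∪ Finset.Ioc k d := by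
      ext x; simp only [Finset.mem_Icc, Finset.mem_union, Finset.mem_Ioc]; omega
    have hd : Disjoint (Finset.Icc 1 k) (Finset.Ioc k d) := by
      rw [Finset.disjoint_left]; intro x
      simp only [Finset.mem_Icc, Finset.mem_Ioc]; omega
    rw [hF, hu, Finset.sum_union hd, hFk, Finset.mul_sum]
    congr 1
    refine Finset.sum_congr rfl fun j hj => ?_
    rw [Finset.mem_Icc] at hj
    rw [← mul_assoc, ← pow_add]
    congr 2; omega
  set G := ∑ j ∈ Finset.Ioc k d,
      (MvPolynomial.X 0 : MvPolynomial (Fin (n+1)) K) ^ (d - j) *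
        MvPolynomial.rename Fin.succ (f j) with hG
  have hfj : ∀ j, s ^ j ∣ MvPolynomial.aeval a (MvPolynomial.rename Fin.succ (f j)) := by
    intro j
    rw [MvPolynomial.aeval_rename]
    exact aux_dvd _ (hf j) _ _ hai'
  have hGa : s ^ k ∣ MvPolynomial.aeval a G := by
    rw [hG, map_sum]
    refine Finset.dvd_sum fun j hj => ?_
    rw [Finset.mem_Ioc] at hj
    rw [map_mul]
    exact Dvd.dvd.mul_left ((pow_dvd_pow s hj.1.le).trans (hfj j)) _
  have hDG : s ^ k ∣ ∑ i, b i * MvPolynomial.aeval a (MvPolynomial.pderiv i G) := by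
    have : ∑ i, b i * MvPolynomial.aeval a (MvPolynomial.pderiv i G) =
        ∑ j ∈ Finset.Ioc k d, ∑ i, b i * MvPolynomial.aeval a (MvPolynomial.pderiv i
          ((MvPolynomial.X 0 : MvPolynomial (Fin (n+1)) K) ^ (d - j) *
        MvPolynomial.rename Fin.succ (f j))) := by
      rw [Finset.sum_comm]
      refine Finset.sum_congr rfl fun i _ => ?_
      rw [hG, map_sum, map_sum, Finset.mul_sum]
    rw [this]
    refine Finset.dvd_sum fun j hj => ?_
    rw [Finset.mem_Ioc] at hj
    rw [aux_D_mul]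
    refine dvd_add (Dvd.dvd.mul_left ((pow_dvd_pow s hj.1.le).trans (hfj j)) _)
      (Dvd.dvd.mul_left ((pow_dvd_pow s (by omega)).trans
        (aux_D_rename (f j) (hf j) a b s hai')) _)
  have hcancel : ∀ y, s ^ k ∣ a 0 ^ (d - k) * y ↔ s ^ k ∣ y := fun y =>
    ⟨fun h => hs.pow_dvd_of_dvd_mul_left k (fun h' => ha0 (hs.dvd_of_dvd_pow h')) h,
      fun h => Dvd.dvd.mul_left h _⟩
  have hFka : s ^ k ∣ MvPolynomial.aeval a Fk := by
    rw [hFG, map_add, dvd_add_left hGa, map_mul, map_pow, MvPolynomial.aeval_X,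
      hcancel] at hcontact
    exact hcontact
  rw [hFG, aux_D_add, dvd_add_left hDG, aux_D_mul, dvd_add_right (Dvd.dvd.mul_left hFka _),
    map_pow, MvPolynomial.aeval_X, hcancel]
end

section
/- Suppose 1 ≤ k ≤ d and s^k divides F(a). Then for every index 0 ≤ i ≤ n, s^k divides (∂F/∂x_i)(a) − a_0^{d−k} · (∂F_k/∂x_i)(a) in K[s,t]. -/
open MvPolynomial in
theorem pow_dvd_aeval_homog {K : Type} [Field K] {n m : ℕ} (P : MvPolynomial (Fin n) K)
    (hP : P.IsHomogeneous m) (s : MvPolynomial (Fin 2) K) (b : Fin n → MvPolynomial (Fin 2) K)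
    (hb : ∀ i, s ∣ b i) : s ^ m ∣ aeval b P := by
  rw [aeval_def, eval₂_eq']
  refine Finset.dvd_sum fun e he => Dvd.dvd.mul_left ?_ _
  have h := hP (mem_support_iff.mp he)
  have h2 : ∑ i, e i = m := by
    rw [← h, Finsupp.weight_apply, Finsupp.sum_fintype] <;> simp
  rw [← h2, ← Finset.prod_pow_eq_pow_sum]
  exact Finset.prod_dvd_prod_of_dvd _ _ fun i _ => pow_dvd_pow_of_dvd (hb i) _

open MvPolynomial in
theorem pow_dvd_aeval_pderiv {K : Type} [Field K] {n m : ℕ} (P : MvPolynomial (Fin n) K)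
    (hP : P.IsHomogeneous m) (s : MvPolynomial (Fin 2) K) (a : Fin (n+1) → MvPolynomial (Fin 2) K)
    (hb : ∀ i, i ≠ 0 → s ∣ a i) (i : Fin (n+1)) :
    s ^ (m - 1) ∣ aeval a (pderiv i (rename Fin.succ P)) := by
  induction i using Fin.cases with
  | zero =>
    rw [pderiv_eq_zero_of_notMem_vars]
    · simp
    · intro h
      have := vars_rename Fin.succ P h
      simp [Fin.succ_ne_zero] at this
  | succ i =>
    rw [pderiv_rename (Fin.succ_injective n), aeval_rename]
    exact pow_dvd_aeval_homog _ hP.pderiv s _ fun i => hb _ (Fin.succ_ne_zero i)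

/-- **The congruence `(∂F/∂x_i)(a) ≡ a_0^{d−k} (∂F_k/∂x_i)(a) mod s^k`.**
With `F = ∑_{j=1}^d x_0^{d−j} f_j` (each `f_j ∈ K[x_1,…,x_n]` homogeneous of degree `j` or
zero), `F_k = ∑_{j=1}^k x_0^{k−j} f_j`, and `a` a tuple of linear forms in `K[s,t]` with
`s ∤ a_0` and `s ∣ a_i` for `i ≥ 1`: if `1 ≤ k ≤ d` and `s^k ∣ F(a)`, then for every index
`i`, `s^k ∣ (∂F/∂x_i)(a) − a_0^{d−k}·(∂F_k/∂x_i)(a)`.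
Here `K[s,t] = MvPolynomial (Fin 2) K` with `s = X 0`. -/
theorem pderiv_congruence_mod_sk {K : Type} [Field K] [CharZero K]
    (n d k : ℕ) (hn : 1 ≤ n) (hk1 : 1 ≤ k) (hkd : k ≤ d)
    (f : ℕ → MvPolynomial (Fin n) K) (hf : ∀ j, (f j).IsHomogeneous j)
    (F Fk : MvPolynomial (Fin (n+1)) K)
    (hF : F = ∑ j ∈ Finset.Icc 1 d,
      MvPolynomial.X 0 ^ (d - j) * MvPolynomial.rename Fin.succ (f j))
    (hFk : Fk = ∑ j ∈ Finset.Icc 1 k,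
      MvPolynomial.X 0 ^ (k - j) * MvPolynomial.rename Fin.succ (f j))
    (a : Fin (n+1) → MvPolynomial (Fin 2) K) (ha : ∀ i, (a i).IsHomogeneous 1)
    (ha0 : ¬ (MvPolynomial.X 0 : MvPolynomial (Fin 2) K) ∣ a 0)
    (hai : ∀ i : Fin (n+1), i ≠ 0 → (MvPolynomial.X 0 : MvPolynomial (Fin 2) K) ∣ a i)
    (hcontact : (MvPolynomial.X 0 : MvPolynomial (Fin 2) K) ^ k ∣ MvPolynomial.aeval a F) :
    ∀ i : Fin (n+1), (MvPolynomial.X 0 : MvPolynomial (Fin 2) K) ^ k ∣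
      MvPolynomial.aeval a (MvPolynomial.pderiv i F) -
        a 0 ^ (d - k) * MvPolynomial.aeval a (MvPolynomial.pderiv i Fk) := by
  intro i
  set s : MvPolynomial (Fin 2) K := MvPolynomial.X 0 with hs
  have hsp : Prime s := MvPolynomial.X_prime
  have key : ∃ G : MvPolynomial (Fin (n+1)) K,
      F = MvPolynomial.X 0 ^ (d - k) * Fk + G ∧ s ^ k ∣ MvPolynomial.aeval a G ∧
      s ^ k ∣ MvPolynomial.aeval a (MvPolynomial.pderiv i G) := by
    refine ⟨∑ j ∈ Finset.Ioc k d, MvPolynomial.X 0 ^ (d - j) * MvPolynomial.rename Fin.succ (f j),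
      ?_, ?_, ?_⟩
    · have hu : Finset.Icc 1 d = Finset.Icc 1 k ∪ Finset.Ioc k d := by
        ext x; simp; omega
      have hd : Disjoint (Finset.Icc 1 k) (Finset.Ioc k d) := by
        rw [Finset.disjoint_left]; intro x; simp; omega
      rw [hF, hFk, hu, Finset.sum_union hd, Finset.mul_sum]
      congr 1
      refine Finset.sum_congr rfl fun j hj => ?_
      rw [Finset.mem_Icc] at hj
      rw [← mul_assoc, ← pow_add]
      congr 2
      omega
    · rw [map_sum]
      refine Finset.dvd_sum fun j hj => ?_
      rw [Finset.mem_Ioc] at hj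
      rw [map_mul, MvPolynomial.aeval_rename]
      exact Dvd.dvd.mul_left ((pow_dvd_pow s hj.1.le).trans
        (pow_dvd_aeval_homog _ (hf j) s _ fun i => hai _ (Fin.succ_ne_zero i))) _
    · rw [map_sum, map_sum]
      refine Finset.dvd_sum fun j hj => ?_
      rw [Finset.mem_Ioc] at hj
      rw [Derivation.leibniz, map_add, smul_eq_mul, smul_eq_mul, map_mul, map_mul]
      refine dvd_add (Dvd.dvd.mul_left ?_ _) (Dvd.dvd.mul_right ?_ _)
      · exact (pow_dvd_pow s (by omega)).trans (pow_dvd_aeval_pderiv _ (hf j) s a hai i)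
      · rw [MvPolynomial.aeval_rename]
        exact (pow_dvd_pow s hj.1.le).trans
          (pow_dvd_aeval_homog _ (hf j) s _ fun i => hai _ (Fin.succ_ne_zero i))
  obtain ⟨G, hG, h1, h2⟩ := key
  have h3 : s ^ k ∣ MvPolynomial.aeval a Fk := by
    rw [hG, map_add, map_mul, map_pow, MvPolynomial.aeval_X] at hcontact
    have h4 := (dvd_add_left h1).mp hcontact
    exact hsp.pow_dvd_of_dvd_mul_left k (fun h => ha0 (hsp.dvd_of_dvd_pow h)) h4
  rw [hG, map_add, Derivation.leibniz, map_add, map_add, smul_eq_mul, smul_eq_mul, map_mul, map_mul,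
    map_pow, MvPolynomial.aeval_X, add_assoc, add_sub_cancel_left]
  exact dvd_add (Dvd.dvd.mul_right h3 _) h2
end

section
/- For every 1 ≤ k ≤ d, s^{k+1} divides F(a) − a_0^{d−k} · F_k(a) in K[s,t]. Consequently, if F(a) is nonzero, divisible by s^k but not by s^{k+1} (i.e., the line meets X = {F = 0} at p = [1:0:⋯:0] to order exactly k), then F_k(a) = c · s^k for some nonzero scalar c ∈ K; in particular F_k(a) is a nonzero multiple of s^k. -/
theorem pow_dvd_aeval_aux {K : Type} [Field K] {n j : ℕ} (p : MvPolynomial (Fin n) K)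
    (hp : p.IsHomogeneous j) (b : Fin n → MvPolynomial (Fin 2) K) (s : MvPolynomial (Fin 2) K)
    (hb : ∀ i, s ∣ b i) : s ^ j ∣ MvPolynomial.aeval b p := by
  rw [MvPolynomial.aeval_def, MvPolynomial.eval₂_eq]
  refine Finset.dvd_sum fun m hm => Dvd.dvd.mul_left ?_ _
  rw [hp.degree_eq_sum_deg_support hm, ← Finset.prod_pow_eq_pow_sum]
  exact Finset.prod_dvd_prod_of_dvd _ _ fun i _ => pow_dvd_pow_of_dvd (hb i) _

/-- **The congruence `F(a) ≡ a_0^{d−k} F_k(a) mod s^{k+1}`.**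
With `F = ∑_{j=1}^d x_0^{d−j} f_j` (each `f_j ∈ K[x_1,…,x_n]` homogeneous of degree `j` or
zero), `F_k = ∑_{j=1}^k x_0^{k−j} f_j`, and `a` a tuple of linear forms in `K[s,t]` with
`s ∤ a_0` and `s ∣ a_i` for `i ≥ 1`: for every `1 ≤ k ≤ d`,
`s^{k+1} ∣ F(a) − a_0^{d−k}·F_k(a)`. Consequently, if `F(a)` is nonzero, divisible by `s^k`
but not by `s^{k+1}`, then `F_k(a) = c·s^k` for some nonzero scalar `c ∈ K`.
Here `K[s,t] = MvPolynomial (Fin 2) K` with `s = X 0`. -/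
theorem truncation_congruence_mod_sk {K : Type} [Field K] [CharZero K]
    (n d k : ℕ) (hn : 1 ≤ n) (hk1 : 1 ≤ k) (hkd : k ≤ d)
    (f : ℕ → MvPolynomial (Fin n) K) (hf : ∀ j, (f j).IsHomogeneous j)
    (F Fk : MvPolynomial (Fin (n+1)) K)
    (hF : F = ∑ j ∈ Finset.Icc 1 d,
      MvPolynomial.X 0 ^ (d - j) * MvPolynomial.rename Fin.succ (f j))
    (hFk : Fk = ∑ j ∈ Finset.Icc 1 k,
      MvPolynomial.X 0 ^ (k - j) * MvPolynomial.rename Fin.succ (f j))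
    (a : Fin (n+1) → MvPolynomial (Fin 2) K) (ha : ∀ i, (a i).IsHomogeneous 1)
    (ha0 : ¬ (MvPolynomial.X 0 : MvPolynomial (Fin 2) K) ∣ a 0)
    (hai : ∀ i : Fin (n+1), i ≠ 0 → (MvPolynomial.X 0 : MvPolynomial (Fin 2) K) ∣ a i) :
    ((MvPolynomial.X 0 : MvPolynomial (Fin 2) K) ^ (k + 1) ∣
      MvPolynomial.aeval a F - a 0 ^ (d - k) * MvPolynomial.aeval a Fk) ∧
    (MvPolynomial.aeval a F ≠ 0 →
      (MvPolynomial.X 0 : MvPolynomial (Fin 2) K) ^ k ∣ MvPolynomial.aeval a F →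
      ¬ (MvPolynomial.X 0 : MvPolynomial (Fin 2) K) ^ (k + 1) ∣ MvPolynomial.aeval a F →
      ∃ c : K, c ≠ 0 ∧ MvPolynomial.aeval a Fk =
        MvPolynomial.C c * (MvPolynomial.X 0 : MvPolynomial (Fin 2) K) ^ k) := by
  have hs : Prime (MvPolynomial.X 0 : MvPolynomial (Fin 2) K) := MvPolynomial.X_prime
  have hFa : MvPolynomial.aeval a F = ∑ j ∈ Finset.Icc 1 d,
      a 0 ^ (d - j) * MvPolynomial.aeval (a ∘ Fin.succ) (f j) := by
    simp only [hF, map_sum, map_mul, map_pow, MvPolynomial.aeval_X, MvPolynomial.aeval_rename]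
  have hFka : MvPolynomial.aeval a Fk = ∑ j ∈ Finset.Icc 1 k,
      a 0 ^ (k - j) * MvPolynomial.aeval (a ∘ Fin.succ) (f j) := by
    simp only [hFk, map_sum, map_mul, map_pow, MvPolynomial.aeval_X, MvPolynomial.aeval_rename]
  have h1 : (MvPolynomial.X 0 : MvPolynomial (Fin 2) K) ^ (k + 1) ∣
      MvPolynomial.aeval a F - a 0 ^ (d - k) * MvPolynomial.aeval a Fk := by
    have hsub : Finset.Icc 1 k ⊆ Finset.Icc 1 d := Finset.Icc_subset_Icc_right hkd
    have e : a 0 ^ (d - k) * MvPolynomial.aeval a Fk = ∑ j ∈ Finset.Icc 1 k,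
        a 0 ^ (d - j) * MvPolynomial.aeval (a ∘ Fin.succ) (f j) := by
      rw [hFka, Finset.mul_sum]
      refine Finset.sum_congr rfl fun j hj => ?_
      rw [Finset.mem_Icc] at hj
      rw [← mul_assoc, ← pow_add]
      congr 2
      omega
    rw [e, hFa, ← Finset.sum_sdiff hsub, add_sub_cancel_right]
    refine Finset.dvd_sum fun j hj => Dvd.dvd.mul_left ?_ _
    simp only [Finset.mem_sdiff, Finset.mem_Icc] at hj
    exact (pow_dvd_pow _ (by omega)).trans
      (pow_dvd_aeval_aux (f j) (hf j) _ _ fun i => hai _ (Fin.succ_ne_zero i))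
  refine ⟨h1, fun _ h2 h3 => ?_⟩
  have hne : MvPolynomial.aeval a Fk ≠ 0 := by
    intro h
    rw [h, mul_zero, sub_zero] at h1
    exact h3 h1
  have hdvd : (MvPolynomial.X 0 : MvPolynomial (Fin 2) K) ^ k ∣ MvPolynomial.aeval a Fk := by
    refine hs.pow_dvd_of_dvd_mul_left k (fun h => ha0 (hs.dvd_of_dvd_pow h)) (a := a 0 ^ (d - k)) ?_
    exact (dvd_sub_right h2).1 ((pow_dvd_pow _ (Nat.le_succ k)).trans h1)
  have hhom : (MvPolynomial.aeval a Fk).IsHomogeneous k := by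
    rw [hFka]
    refine MvPolynomial.IsHomogeneous.sum _ _ _ fun j hj => ?_
    rw [Finset.mem_Icc] at hj
    have := ((ha 0).pow (k - j)).mul ((hf j).aeval (a ∘ Fin.succ) (fun i => ha i.succ))
    convert this using 1
    omega
  obtain ⟨q, hq⟩ := hdvd
  have hq0 : q ≠ 0 := by
    rintro rfl
    exact hne (by rw [hq, mul_zero])
  have hdeg := hhom.totalDegree hne
  rw [hq, MvPolynomial.totalDegree_mul_of_isDomain (pow_ne_zero _ hs.ne_zero) hq0,
    MvPolynomial.totalDegree_X_pow] at hdeg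
  have hqC := MvPolynomial.totalDegree_eq_zero_iff_eq_C.1 (show q.totalDegree = 0 by omega)
  refine ⟨q.coeff 0, fun h => hq0 (by rw [hqC, h, map_zero]), ?_⟩
  rw [← hqC, hq, mul_comm]
end
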